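/- Let R be a ring and let 0 → K → M → N → 0 be a short exact sequence of R-modules. If Ext^i(M,M) = 0, Ext^i(M,N) = 0, Ext^i(N,M) = 0 and Ext^i(N,N) = 0 all hold for all sufficiently large i, then Ext^i(K,K) = 0 for all sufficiently large i. (This is the key step in the proof that the kernel of an irreducible epimorphism ending at a module of finite extension degree again has finite extension degree.) -/

import Mathlib

open CategoryTheory

universe u

/-- The `i`-th Ext group of the `R`-modules `M` and `N`. -/
noncomputable abbrev extGroup (R : Type u) [Ring R] (i : ℕ) (M N : ModuleCat.{u} R) : Type u :=
  ((Ext ℤ (ModuleCat.{u} R) i).obj (Opposite.op M)).obj N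

lemma extGroup_succ_iff (R : Type u) [Ring R] (n : ℕ) (X Y : ModuleCat.{u} R) :
    Subsingleton (extGroup R (n + 1) X Y) ↔ Subsingleton (Abelian.Ext.{u} X Y (n + 1)) := by
  let P : ProjectiveResolution X := projectiveResolution X
  trans ∀ f : P.complex.X (n + 1) ⟶ Y, P.complex.d (n + 2) (n + 1) ≫ f = 0 →
    ∃ g : P.complex.X n ⟶ Y, P.complex.d (n + 1) n ≫ g = f
  · rw [← ModuleCat.isZero_iff_subsingleton, (P.isoExt (R := ℤ) (n + 1) Y).isZero_iff,
      ← HomologicalComplex.exactAt_iff_isZero_homology,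
      HomologicalComplex.exactAt_iff' _ n (n + 1) (n + 2) (by simp) (by simp),
      ShortComplex.moduleCat_exact_iff]
    rfl
  · constructor
    · intro h
      refine subsingleton_of_forall_eq 0 fun x => ?_
      obtain ⟨f, hf, rfl⟩ := P.extMk_surjective x (n + 2) rfl
      exact (P.extMk_eq_zero_iff f (n + 2) rfl hf n rfl).2 (h f hf)
    · intro h f hf
      exact (P.extMk_eq_zero_iff f (n + 2) rfl hf n rfl).1 (Subsingleton.elim _ _)

lemma eventually_ext_iff (R : Type u) [Ring R] (X Y : ModuleCat.{u} R) :
    (∃ N₀, ∀ i, N₀ ≤ i → Subsingleton (extGroup R i X Y)) ↔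
      ∃ N₀, ∀ i, N₀ ≤ i → Subsingleton (Abelian.Ext.{u} X Y i) := by
  constructor
  · rintro ⟨a, h⟩
    refine ⟨a + 1, fun i hi => ?_⟩
    obtain ⟨j, rfl⟩ : ∃ j, i = j + 1 := ⟨i - 1, by omega⟩
    exact (extGroup_succ_iff R j X Y).1 (h _ (by omega))
  · rintro ⟨a, h⟩
    refine ⟨a + 1, fun i hi => ?_⟩
    obtain ⟨j, rfl⟩ : ∃ j, i = j + 1 := ⟨i - 1, by omega⟩
    exact (extGroup_succ_iff R j X Y).2 (h _ (by omega))

lemma eventually_ext_left (R : Type u) [Ring R] (X : ModuleCat.{u} R)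
    (S : ShortComplex (ModuleCat.{u} R)) (hS : S.ShortExact)
    (h₂ : ∃ N₀, ∀ i, N₀ ≤ i → Subsingleton (Abelian.Ext.{u} X S.X₂ i))
    (h₃ : ∃ N₀, ∀ i, N₀ ≤ i → Subsingleton (Abelian.Ext.{u} X S.X₃ i)) :
    ∃ N₀, ∀ i, N₀ ≤ i → Subsingleton (Abelian.Ext.{u} X S.X₁ i) := by
  obtain ⟨a, ha⟩ := h₂
  obtain ⟨b, hb⟩ := h₃
  refine ⟨a + b + 1, fun i hi => subsingleton_of_forall_eq 0 fun x => ?_⟩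
  obtain ⟨j, rfl⟩ : ∃ j, i = j + 1 := ⟨i - 1, by omega⟩
  have := ha (j + 1) (by omega)
  have := hb j (by omega)
  obtain ⟨y, rfl⟩ := Abelian.Ext.covariant_sequence_exact₁ X hS x (Subsingleton.elim _ _) rfl
  rw [Subsingleton.elim y 0, Abelian.Ext.zero_comp]

/-- Let `R` be a ring and `0 → K → M → N → 0` a short exact sequence of `R`-modules.
If `Ext^i(M,M)`, `Ext^i(M,N)`, `Ext^i(N,M)` and `Ext^i(N,N)` all vanish for all sufficiently
large `i`, then `Ext^i(K,K) = 0` for all sufficiently large `i`. -/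
theorem stmt_5 (R : Type u) [Ring R]
    (K M N : ModuleCat.{u} R)
    (f : K ⟶ M) (g : M ⟶ N)
    (hf : Function.Injective f) (hfg : Function.Exact f g) (hg : Function.Surjective g)
    (hMM : ∃ N₀, ∀ i, N₀ ≤ i → Subsingleton (extGroup R i M M))
    (hMN : ∃ N₀, ∀ i, N₀ ≤ i → Subsingleton (extGroup R i M N))
    (hNM : ∃ N₀, ∀ i, N₀ ≤ i → Subsingleton (extGroup R i N M))
    (hNN : ∃ N₀, ∀ i, N₀ ≤ i → Subsingleton (extGroup R i N N)) :
    ∃ N₀, ∀ i, N₀ ≤ i → Subsingleton (extGroup R i K K) := by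
  have hS : (ShortComplex.mk f g (by ext x; exact hfg.apply_apply_eq_zero x)).ShortExact :=
    { exact := (ShortComplex.ShortExact.moduleCat_exact_iff_function_exact _).2 hfg
      mono_f := (ModuleCat.mono_iff_injective f).2 hf
      epi_g := (ModuleCat.epi_iff_surjective g).2 hg }
  rw [eventually_ext_iff] at *
  obtain ⟨a, ha⟩ := eventually_ext_left R M _ hS hMM hMN
  obtain ⟨b, hb⟩ := eventually_ext_left R N _ hS hNM hNN
  refine ⟨a + b, fun i hi => subsingleton_of_forall_eq 0 fun x => ?_⟩
  have := ha i (by omega)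
  have := hb (1 + i) (by omega)
  obtain ⟨y, rfl⟩ := Abelian.Ext.contravariant_sequence_exact₁ hS K x rfl
    (this.elim _ _)
  rw [(ha i (by omega)).elim y 0, Abelian.Ext.comp_zero]
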